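/- arXiv:1409.0732 — 2 statements merged into one kernel-verified Lean document; each statement's English description precedes it below -/
import Mathlib

section
/- Let (ξ_N)_{N≥1} be the dyadic van der Corput sequence. Then liminf_N N·e_1({ξ_1,...,ξ_N}, U([0,1])) = 1/4, attained along the subsequence N = 2^{n-1}, and limsup_N N·e_1({ξ_1,...,ξ_N}, U([0,1])) = 9/32, attained along N = 3·2^{n-1}. -/
open MeasureTheory Metric Filter

/-- The dyadic van der Corput sequence: `vdc N = ∑ n_k / 2^(k+1)` where `N = ∑ n_k 2^k`. -/
noncomputable def vdc (N : ℕ) : ℝ :=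
  ∑ k ∈ Finset.range N, if N.testBit k then ((1 : ℝ) / 2 ^ (k + 1)) else 0

/-- The `L^1` mean quantization error of `{vdc 1, ..., vdc N}` for `U([0,1])`. -/
noncomputable def e1vdc (N : ℕ) : ℝ :=
  ∫ u in Set.Icc (0 : ℝ) 1, infDist u (vdc '' Set.Icc 1 N)

lemma vdc_eq_sum (N M : ℕ) (h : N ≤ M) :
    vdc N = ∑ k ∈ Finset.range M, if N.testBit k then ((1 : ℝ) / 2 ^ (k + 1)) else 0 := by
  unfold vdc
  apply Finset.sum_subset
  · intro x hx
    simp only [Finset.mem_range] at *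
    omega
  · intro x _ hx
    simp only [Finset.mem_range, not_lt] at hx
    have : N < 2 ^ x := lt_of_le_of_lt hx Nat.lt_two_pow_self
    simp [Nat.testBit_lt_two_pow this]

lemma vdc_even (j : ℕ) : vdc (2 * j) = vdc j / 2 := by
  rw [vdc_eq_sum (2 * j) (2 * j + 1) (by omega), vdc_eq_sum j (2 * j) (by omega),
    Finset.sum_range_succ', Finset.sum_div]
  have h0 : (2 * j).testBit 0 = false := by simp
  rw [h0]
  simp only [Bool.false_eq_true, if_false, add_zero]
  apply Finset.sum_congr rfl
  intro k _
  have : (2 * j).testBit (k + 1) = j.testBit k := by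
    rw [Nat.testBit_succ]; congr 1; omega
  rw [this]
  split_ifs
  · rw [pow_succ _ (k + 1)]; field_simp
  · simp

lemma vdc_odd (j : ℕ) : vdc (2 * j + 1) = (1 + vdc j) / 2 := by
  rw [vdc_eq_sum (2 * j + 1) (2 * j + 1) (by omega), vdc_eq_sum j (2 * j) (by omega),
    Finset.sum_range_succ', add_div, Finset.sum_div]
  have h0 : (2 * j + 1).testBit 0 = true := by simp
  rw [h0, add_comm]
  simp only [if_true, zero_add, pow_one]
  congr 1
  apply Finset.sum_congr rfl
  intro k _
  have : (2 * j + 1).testBit (k + 1) = j.testBit k := by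
    rw [Nat.testBit_succ]; congr 1; omega
  rw [this]
  split_ifs
  · rw [pow_succ _ (k + 1)]; field_simp
  · simp

lemma vdc_zero : vdc 0 = 0 := by simp [vdc]

lemma vdc_mem (N : ℕ) : vdc N ∈ Set.Icc (0 : ℝ) 1 := by
  induction N using Nat.strong_induction_on with
  | _ N ih =>
    rcases Nat.eq_zero_or_pos N with h | h
    · subst h; simp [vdc_zero]
    · rcases Nat.even_or_odd' N with ⟨j, hj | hj⟩
      · have := ih j (by omega)
        rw [hj, vdc_even]
        constructor <;> linarith [this.1, this.2]
      · have := ih j (by omega)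
        rw [hj, vdc_odd]
        constructor <;> linarith [this.1, this.2]

lemma vdc_two_pow (n : ℕ) : vdc (2 ^ n) = 1 / 2 ^ n / 2 := by
  induction n with
  | zero =>
    have := vdc_odd 0
    simp [vdc_zero] at this
    simp [this]
  | succ n ih => rw [pow_succ', vdc_even, ih, pow_succ']; field_simp

lemma vdc_two_pow_sub (n : ℕ) : vdc (2 ^ n - 1) = 1 - 1 / 2 ^ n := by
  induction n with
  | zero => simp [vdc_zero]
  | succ n ih =>
    have : 2 ^ (n + 1) - 1 = 2 * (2 ^ n - 1) + 1 := by
      have := Nat.one_le_two_pow (n := n)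
      rw [pow_succ']; omega
    rw [this, vdc_odd, ih, pow_succ']; field_simp; ring

/-- Augmented point set. -/
noncomputable def augP (N : ℕ) : Set ℝ := insert 1 (vdc '' Set.Iio N)

/-- Its quantization error. -/
noncomputable def augE (N : ℕ) : ℝ := ∫ u in (0 : ℝ)..1, infDist u (augP N)

lemma one_mem_augP (N : ℕ) : (1 : ℝ) ∈ augP N := Set.mem_insert _ _

lemma vdc_mem_augP {N j : ℕ} (h : j < N) : vdc j ∈ augP N :=
  Set.mem_insert_of_mem _ ⟨j, h, rfl⟩

lemma zero_mem_augP {N : ℕ} (h : 0 < N) : (0 : ℝ) ∈ augP N := by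
  rw [← vdc_zero]; exact vdc_mem_augP h

lemma augP_sub (N : ℕ) : augP N ⊆ Set.Icc 0 1 := by
  rintro x (rfl | ⟨j, _, rfl⟩)
  · simp
  · exact vdc_mem j

/-- Gluing of two scaled copies. -/
def glue (Q R : Set ℝ) : Set ℝ := (fun x => x / 2) '' Q ∪ (fun x => (1 + x) / 2) '' R

lemma augP_glue (N a b : ℕ) (hb : 0 < b)
    (h0 : ∀ j, 2 * j < N ↔ j < a) (h1 : ∀ j, 2 * j + 1 < N ↔ j < b) :
    augP N = glue (augP a) (augP b) := by
  ext x
  constructor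
  · rintro (rfl | ⟨j, hj, rfl⟩)
    · right; exact ⟨1, one_mem_augP b, by norm_num⟩
    · rcases Nat.even_or_odd' j with ⟨i, rfl | rfl⟩
      · left; exact ⟨vdc i, vdc_mem_augP ((h0 i).1 hj), (vdc_even i).symm⟩
      · right; exact ⟨vdc i, vdc_mem_augP ((h1 i).1 hj), (vdc_odd i).symm⟩
  · rintro (⟨y, (rfl | ⟨j, hj, rfl⟩), rfl⟩ | ⟨y, (rfl | ⟨j, hj, rfl⟩), rfl⟩)
    · have := vdc_mem_augP ((h1 0).2 hb)
      rw [vdc_odd, vdc_zero] at this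
      simpa using this
    · have := vdc_mem_augP ((h0 j).2 hj)
      rwa [vdc_even] at this
    · norm_num; exact one_mem_augP N
    · have := vdc_mem_augP ((h1 j).2 hj)
      rwa [vdc_odd] at this

lemma infDist_eq_of {S T : Set ℝ} {u v : ℝ} (hS : S.Nonempty) (hT : T.Nonempty)
    (h1 : ∀ x ∈ S, ∃ y ∈ T, |v - y| ≤ 2 * |u - x|)
    (h2 : ∀ y ∈ T, ∃ x ∈ S, 2 * |u - x| ≤ |v - y|) :
    infDist u S = infDist v T / 2 := by
  apply le_antisymm
  · have : 2 * infDist u S ≤ infDist v T := by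
      rw [le_infDist hT]
      intro y hy
      obtain ⟨x, hx, h⟩ := h2 y hy
      have := infDist_le_dist_of_mem (x := u) hx
      rw [Real.dist_eq] at *
      linarith
    linarith
  · rw [le_infDist hS]
    intro x hx
    obtain ⟨y, hy, h⟩ := h1 x hx
    have := infDist_le_dist_of_mem (x := v) hy
    rw [Real.dist_eq] at *
    linarith

lemma infDist_glue_left {Q R : Set ℝ} (hQ : Q ⊆ Set.Icc 0 1) (hR : R ⊆ Set.Icc 0 1)
    (h1 : (1 : ℝ) ∈ Q) {u : ℝ} (hu : u ∈ Set.Icc (0 : ℝ) 1) :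
    infDist (u / 2) (glue Q R) = infDist u Q / 2 := by
  have key : ∀ y : ℝ, 2 * |u / 2 - y / 2| = |u - y| := by
    intro y
    rw [← sub_div, abs_div, abs_two]; ring
  apply infDist_eq_of ⟨_, Or.inl ⟨1, h1, rfl⟩⟩ ⟨1, h1⟩
  · rintro x (⟨y, hy, rfl⟩ | ⟨y, hy, rfl⟩)
    · exact ⟨y, hy, (key y).ge⟩
    · refine ⟨1, h1, ?_⟩
      have := hR hy
      have h2 := neg_le_abs (u / 2 - (1 + y) / 2)
      rw [abs_of_nonpos (by linarith [hu.2])]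
      simp only
      linarith [this.1]
  · intro y hy
    exact ⟨y / 2, Or.inl ⟨y, hy, rfl⟩, (key y).le⟩

lemma infDist_glue_right {Q R : Set ℝ} (hQ : Q ⊆ Set.Icc 0 1) (hR : R ⊆ Set.Icc 0 1)
    (h1 : (0 : ℝ) ∈ R) {u : ℝ} (hu : u ∈ Set.Icc (0 : ℝ) 1) :
    infDist (u / 2 + 1 / 2) (glue Q R) = infDist u R / 2 := by
  have key : ∀ y : ℝ, 2 * |u / 2 + 1 / 2 - (1 + y) / 2| = |u - y| := by
    intro y
    rw [show u / 2 + 1 / 2 - (1 + y) / 2 = (u - y) / 2 by ring, abs_div, abs_two]; ring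
  apply infDist_eq_of ⟨_, Or.inr ⟨0, h1, rfl⟩⟩ ⟨0, h1⟩
  · rintro x (⟨y, hy, rfl⟩ | ⟨y, hy, rfl⟩)
    · refine ⟨0, h1, ?_⟩
      have := hQ hy
      have h2 := le_abs_self (u / 2 + 1 / 2 - y / 2)
      rw [abs_of_nonneg (by linarith [hu.1])]
      simp only
      linarith [this.2]
    · exact ⟨y, hy, (key y).ge⟩
  · intro y hy
    exact ⟨(1 + y) / 2, Or.inr ⟨y, hy, rfl⟩, (key y).le⟩

lemma cont_infDist (S : Set ℝ) : Continuous (fun u : ℝ => infDist u S) :=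
  continuous_infDist_pt S

lemma integral_glue {Q R : Set ℝ} (hQ : Q ⊆ Set.Icc 0 1) (hR : R ⊆ Set.Icc 0 1)
    (h1 : (1 : ℝ) ∈ Q) (h0 : (0 : ℝ) ∈ R) :
    ∫ u in (0 : ℝ)..1, infDist u (glue Q R) =
      ((∫ u in (0 : ℝ)..1, infDist u Q) + ∫ u in (0 : ℝ)..1, infDist u R) / 4 := by
  have hc := cont_infDist (glue Q R)
  rw [← intervalIntegral.integral_add_adjacent_intervals (b := 1 / 2)
    (hc.intervalIntegrable _ _) (hc.intervalIntegrable _ _)]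
  have e1 : ∫ u in (0 : ℝ)..1, infDist (u / 2) (glue Q R)
      = (∫ u in (0 : ℝ)..1, infDist u Q) / 2 := by
    rw [← intervalIntegral.integral_div]
    apply intervalIntegral.integral_congr
    intro u hu
    rw [Set.uIcc_of_le zero_le_one] at hu
    exact infDist_glue_left hQ hR h1 hu
  have e2 : ∫ u in (0 : ℝ)..1, infDist (u / 2 + 1 / 2) (glue Q R)
      = (∫ u in (0 : ℝ)..1, infDist u R) / 2 := by
    rw [← intervalIntegral.integral_div]
    apply intervalIntegral.integral_congr
    intro u hu
    rw [Set.uIcc_of_le zero_le_one] at hu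
    exact infDist_glue_right hQ hR h0 hu
  rw [intervalIntegral.integral_comp_div (fun u => infDist u (glue Q R)) two_ne_zero] at e1
  rw [intervalIntegral.integral_comp_div_add (fun u => infDist u (glue Q R)) two_ne_zero] at e2
  norm_num at e1 e2 ⊢
  linarith

lemma augE_even (N : ℕ) (h : 0 < N) : augE (2 * N) = augE N / 2 := by
  unfold augE
  rw [augP_glue (2 * N) N N h (by intros; omega) (by intros; omega),
    integral_glue (augP_sub _) (augP_sub _) (one_mem_augP _) (zero_mem_augP h)]
  ring

lemma augE_odd (N : ℕ) (h : 0 < N) : augE (2 * N + 1) = (augE (N + 1) + augE N) / 4 := by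
  unfold augE
  rw [augP_glue (2 * N + 1) (N + 1) N h (by intros; omega) (by intros; omega),
    integral_glue (augP_sub _) (augP_sub _) (one_mem_augP _) (zero_mem_augP h)]

lemma augE_one : augE 1 = 1 / 4 := by
  have hP : augP 1 = {1, 0} := by
    unfold augP
    have : Set.Iio 1 = ({0} : Set ℕ) := by ext; simp
    rw [this, Set.image_singleton, vdc_zero]
  have hc := cont_infDist (augP 1)
  unfold augE
  rw [← intervalIntegral.integral_add_adjacent_intervals (b := 1 / 2)
    (hc.intervalIntegrable _ _) (hc.intervalIntegrable _ _)]
  have e1 : ∫ u in (0 : ℝ)..(1 / 2), infDist u (augP 1) = ∫ u in (0 : ℝ)..(1 / 2), u := by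
    apply intervalIntegral.integral_congr
    intro u hu
    rw [Set.uIcc_of_le (by norm_num)] at hu
    simp only
    apply le_antisymm
    · refine (infDist_le_dist_of_mem (zero_mem_augP one_pos)).trans ?_
      rw [Real.dist_eq, sub_zero, abs_of_nonneg hu.1]
    · rw [le_infDist ⟨_, one_mem_augP 1⟩, hP]
      rintro y (rfl | rfl)
      · rw [Real.dist_eq, abs_of_nonpos] <;> linarith [hu.2]
      · rw [Real.dist_eq, abs_of_nonneg] <;> linarith [hu.1]
  have e2 : ∫ u in ((1 : ℝ) / 2)..1, infDist u (augP 1) = ∫ u in ((1 : ℝ) / 2)..1, (1 - u) := by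
    apply intervalIntegral.integral_congr
    intro u hu
    rw [Set.uIcc_of_le (by norm_num)] at hu
    simp only
    apply le_antisymm
    · refine (infDist_le_dist_of_mem (one_mem_augP 1)).trans ?_
      rw [Real.dist_eq, abs_of_nonpos] <;> linarith [hu.2]
    · rw [le_infDist ⟨_, one_mem_augP 1⟩, hP]
      rintro y (rfl | rfl)
      · rw [Real.dist_eq, abs_of_nonpos] <;> linarith [hu.2]
      · rw [Real.dist_eq, abs_of_nonneg] <;> linarith [hu.1]
  rw [e1, e2, intervalIntegral.integral_sub (by simp) (by simp)]
  simp only [integral_id, intervalIntegral.integral_const]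
  norm_num

lemma augE_formula (n : ℕ) : ∀ M : ℕ, 2 ^ n ≤ M → M ≤ 2 ^ (n + 1) →
    augE M = 1 / 2 ^ n / 4 * (1 - ((M : ℝ) - 2 ^ n) * (1 / 2 ^ n) / 2) := by
  induction n with
  | zero =>
    intro M h1 h2
    have : M = 1 ∨ M = 2 * 1 := by simp at h1 h2; omega
    rcases this with rfl | rfl
    · rw [augE_one]; norm_num
    · rw [augE_even 1 one_pos, augE_one]; norm_num
  | succ n ih =>
    intro M h1 h2
    have hp := Nat.one_le_two_pow (n := n)
    rw [pow_succ'] at h1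
    rw [pow_succ' 2 (n + 1)] at h2
    rcases Nat.even_or_odd' M with ⟨j, rfl | rfl⟩
    · rw [augE_even j (by omega), ih j (by omega) (by omega)]
      push_cast
      rw [pow_succ' (2 : ℝ)]
      field_simp
    · rw [augE_odd j (by omega), ih j (by omega) (by omega), ih (j + 1) (by omega) (by omega)]
      push_cast
      rw [pow_succ' (2 : ℝ)]
      field_simp
      ring

lemma e1vdc_eq (N : ℕ) : e1vdc N = ∫ u in (0 : ℝ)..1, infDist u (vdc '' Set.Icc 1 N) := by
  unfold e1vdc
  rw [intervalIntegral.integral_of_le zero_le_one, integral_Icc_eq_integral_Ioc]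

lemma e1vdc_ge (N : ℕ) (h : 1 ≤ N) : augE (N + 1) ≤ e1vdc N := by
  rw [e1vdc_eq]
  unfold augE
  apply intervalIntegral.integral_mono_on zero_le_one
    ((cont_infDist _).intervalIntegrable _ _) ((cont_infDist _).intervalIntegrable _ _)
  intro u _
  apply infDist_le_infDist_of_subset
  · rintro _ ⟨j, hj, rfl⟩
    exact vdc_mem_augP (by have := hj.2; omega)
  · exact ⟨_, 1, ⟨le_rfl, h⟩, rfl⟩

lemma infDist_le_ramp (n N : ℕ) (hn : 1 ≤ n) (h1 : 2 ^ n ≤ N) (u : ℝ)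
    (hu : u ∈ Set.Icc (0 : ℝ) 1) :
    infDist u (vdc '' Set.Icc 1 N) ≤ infDist u (augP (N + 1)) +
      ((Set.Iic ((1 : ℝ) / 2 ^ n)).indicator (fun _ => (1 : ℝ) / 2 ^ n) u +
      (Set.Ici (1 - (1 : ℝ) / 2 ^ n)).indicator (fun _ => (1 : ℝ) / 2 ^ n) u) := by
  have hp := Nat.one_lt_two_pow (n := n) (by omega)
  have hh : (0 : ℝ) < 1 / 2 ^ n := by positivity
  have m1 : (1 : ℝ) / 2 ^ n / 2 ∈ vdc '' Set.Icc 1 N := ⟨2 ^ n, ⟨by omega, h1⟩, vdc_two_pow n⟩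
  have m2 : (1 : ℝ) - 1 / 2 ^ n ∈ vdc '' Set.Icc 1 N :=
    ⟨2 ^ n - 1, ⟨by omega, by omega⟩, vdc_two_pow_sub n⟩
  generalize (1 : ℝ) / 2 ^ n = h at *
  have i1 : 0 ≤ (Set.Iic h).indicator (fun _ => h) u :=
    Set.indicator_nonneg (fun _ _ => hh.le) u
  have i2 : 0 ≤ (Set.Ici (1 - h)).indicator (fun _ => h) u :=
    Set.indicator_nonneg (fun _ _ => hh.le) u
  rw [← sub_le_iff_le_add, le_infDist ⟨_, one_mem_augP _⟩]
  rintro y (rfl | ⟨j, hj, rfl⟩)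
  · have := infDist_le_dist_of_mem (x := u) m2
    rw [Real.dist_eq] at *
    rw [abs_of_nonpos (by linarith [hu.2] : u - 1 ≤ 0)]
    by_cases hc : u ∈ Set.Ici (1 - h)
    · rw [Set.indicator_of_mem hc] at *
      have hc' : 1 - h ≤ u := hc
      rw [abs_of_nonneg (by linarith)] at this
      linarith [hu.2]
    · have hc' : u < 1 - h := not_le.1 hc
      rw [abs_of_nonpos (by linarith)] at this
      linarith
  · rcases Nat.eq_zero_or_pos j with rfl | hj0
    · rw [vdc_zero]
      have := infDist_le_dist_of_mem (x := u) m1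
      rw [Real.dist_eq] at *
      rw [sub_zero, abs_of_nonneg hu.1]
      by_cases hc : u ∈ Set.Iic h
      · rw [Set.indicator_of_mem hc] at *
        have : |u - h / 2| ≤ u + h := by
          rw [abs_le]; constructor <;> linarith [hu.1]
        linarith
      · have hc' : h < u := not_le.1 hc
        rw [abs_of_nonneg (by linarith)] at this
        linarith
    · have hj' : j < N + 1 := hj
      have hm : vdc j ∈ vdc '' Set.Icc 1 N := ⟨j, ⟨hj0, by omega⟩, rfl⟩
      have := infDist_le_dist_of_mem (x := u) hm
      linarith

lemma e1vdc_le (n N : ℕ) (hn : 1 ≤ n) (h1 : 2 ^ n ≤ N) :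
    e1vdc N ≤ augE (N + 1) + 2 * (1 / 2 ^ n) ^ 2 := by
  have hr := infDist_le_ramp n N hn h1
  have hh : (0 : ℝ) < 1 / 2 ^ n := by positivity
  have hh1 : (1 : ℝ) / 2 ^ n ≤ 1 := by
    rw [div_le_one (by positivity)]; exact one_le_pow₀ (by norm_num)
  unfold augE e1vdc
  rw [intervalIntegral.integral_of_le zero_le_one, ← integral_Icc_eq_integral_Ioc]
  generalize (1 : ℝ) / 2 ^ n = h at *
  have I0 : ∀ S : Set ℝ, IntegrableOn (fun u => infDist u S) (Set.Icc (0 : ℝ) 1) :=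
    fun S => (cont_infDist S).continuousOn.integrableOn_compact isCompact_Icc
  have Ic : IntegrableOn (fun _ : ℝ => h) (Set.Icc (0 : ℝ) 1) :=
    continuous_const.continuousOn.integrableOn_compact isCompact_Icc
  have I1 : IntegrableOn ((Set.Iic h).indicator (fun _ => h)) (Set.Icc (0 : ℝ) 1) :=
    Integrable.indicator Ic measurableSet_Iic
  have I2 : IntegrableOn ((Set.Ici (1 - h)).indicator (fun _ => h)) (Set.Icc (0 : ℝ) 1) :=
    Integrable.indicator Ic measurableSet_Ici
  have := setIntegral_mono_on (I0 _) ((I0 (augP (N + 1))).add (I1.add I2)) measurableSet_Icc hr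
  refine this.trans ?_
  have s1 : ∫ u in Set.Icc (0 : ℝ) 1, (Set.Iic h).indicator (fun _ => h) u = h ^ 2 := by
    rw [setIntegral_indicator measurableSet_Iic]
    have : Set.Icc (0 : ℝ) 1 ∩ Set.Iic h = Set.Icc 0 h := by
      ext x; simp only [Set.mem_inter_iff, Set.mem_Icc, Set.mem_Iic]
      constructor
      · rintro ⟨⟨a, b⟩, c⟩; exact ⟨a, c⟩
      · rintro ⟨a, c⟩; exact ⟨⟨a, by linarith⟩, c⟩
    rw [this]
    simp [hh.le, sq]
  have s2 : ∫ u in Set.Icc (0 : ℝ) 1, (Set.Ici (1 - h)).indicator (fun _ => h) u = h ^ 2 := by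
    rw [setIntegral_indicator measurableSet_Ici]
    have : Set.Icc (0 : ℝ) 1 ∩ Set.Ici (1 - h) = Set.Icc (1 - h) 1 := by
      ext x; simp only [Set.mem_inter_iff, Set.mem_Icc, Set.mem_Ici]
      constructor
      · rintro ⟨⟨a, b⟩, c⟩; exact ⟨c, b⟩
      · rintro ⟨c, b⟩; exact ⟨⟨by linarith, b⟩, c⟩
    rw [this]
    simp [hh.le, sq]
  have e : ∫ u in Set.Icc (0 : ℝ) 1, (infDist u (augP (N + 1)) +
      ((Set.Iic h).indicator (fun _ => h) u + (Set.Ici (1 - h)).indicator (fun _ => h) u))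
      = (∫ u in Set.Icc (0 : ℝ) 1, infDist u (augP (N + 1))) + (h ^ 2 + h ^ 2) := by
    have t1 := integral_add (I0 (augP (N + 1))) (I1.add I2)
    have t2 := integral_add I1 I2
    rw [s1, s2] at t2
    simp only [Pi.add_apply] at t1
    rw [t1, t2]
  refine (le_of_eq e).trans ?_
  linarith

lemma main_bound (n N : ℕ) (hn : 1 ≤ n) (h1 : 2 ^ n ≤ N) (h2 : N < 2 ^ (n + 1)) :
    |(N : ℝ) * e1vdc N - (N / 2 ^ n) * (3 - N / 2 ^ n) / 8| ≤ 5 * (1 / 2 ^ n) := by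
  have a := e1vdc_ge N (Nat.one_le_two_pow.trans h1)
  have b := e1vdc_le n N hn h1
  rw [augE_formula n (N + 1) (by omega) (by omega)] at a b
  have hp : (0 : ℝ) < 2 ^ n := by positivity
  have h1' : (2 : ℝ) ^ n ≤ N := by exact_mod_cast h1
  have h2' : (N : ℝ) ≤ 2 * 2 ^ n := by
    rw [← pow_succ']; exact_mod_cast h2.le
  push_cast at a b
  generalize e1vdc N = E at *
  have hN : (N : ℝ) = (N / 2 ^ n) * 2 ^ n := by field_simp
  have x1 : 1 ≤ (N : ℝ) / 2 ^ n := by rw [le_div_iff₀ hp]; linarith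
  have x2 : (N : ℝ) / 2 ^ n ≤ 2 := by rw [div_le_iff₀ hp]; linarith
  generalize (N : ℝ) / 2 ^ n = x at *
  have hNp : (0 : ℝ) ≤ N := by positivity
  have a' := mul_le_mul_of_nonneg_left a hNp
  have b' := mul_le_mul_of_nonneg_left b hNp
  have c1 : (N : ℝ) * (1 / 2 ^ n / 4 * (1 - ((N : ℝ) + 1 - 2 ^ n) * (1 / 2 ^ n) / 2))
      = x * (3 - x) / 8 - x * (1 / 2 ^ n) / 8 := by
    rw [hN]; field_simp; ring
  have c2 : (N : ℝ) * (2 * (1 / 2 ^ n) ^ 2) = 2 * x * (1 / 2 ^ n) := by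
    rw [hN]; field_simp
  have hh : (0 : ℝ) < 1 / 2 ^ n := by positivity
  rw [mul_add, c1, c2] at b'
  rw [c1] at a'
  generalize (1 : ℝ) / 2 ^ n = h at *
  rw [abs_le]
  constructor <;> nlinarith

lemma bounds_all (N : ℕ) (hN : 2 ≤ N) :
    1 / 4 - 10 / (N : ℝ) ≤ N * e1vdc N ∧ N * e1vdc N ≤ 9 / 32 + 10 / (N : ℝ) := by
  have h1 : 2 ^ Nat.log 2 N ≤ N := Nat.pow_log_le_self 2 (by omega)
  have h2 : N < 2 ^ (Nat.log 2 N + 1) := Nat.lt_pow_succ_log_self (by norm_num) N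
  have hn : 1 ≤ Nat.log 2 N := Nat.log_pos (by norm_num) hN
  generalize Nat.log 2 N = n at *
  have := main_bound n N hn h1 h2
  have hp : (0 : ℝ) < 2 ^ n := by positivity
  have h1' : (2 : ℝ) ^ n ≤ N := by exact_mod_cast h1
  have h2' : (N : ℝ) ≤ 2 * 2 ^ n := by
    rw [← pow_succ']; exact_mod_cast h2.le
  have x1 : 1 ≤ (N : ℝ) / 2 ^ n := by rw [le_div_iff₀ hp]; linarith
  have x2 : (N : ℝ) / 2 ^ n ≤ 2 := by rw [div_le_iff₀ hp]; linarith
  have h10 : 5 * (1 / 2 ^ n) ≤ 10 / (N : ℝ) := by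
    rw [mul_one_div, div_le_div_iff₀ hp (by linarith)]; linarith
  generalize (N : ℝ) / 2 ^ n = x at *
  rw [abs_le] at this
  constructor <;> nlinarith [sq_nonneg (x - 3 / 2)]

lemma tendsto_five : Tendsto (fun n : ℕ => 5 * ((1 : ℝ) / 2 ^ n)) atTop (nhds 0) := by
  have := (tendsto_pow_atTop_nhds_zero_of_lt_one (r := (1 : ℝ) / 2) (by norm_num)
    (by norm_num)).const_mul 5
  simpa [one_div, inv_pow] using this

lemma tendsto_pow2 :
    Tendsto (fun n : ℕ => ((2 ^ n : ℕ) : ℝ) * e1vdc (2 ^ n)) atTop (nhds (1 / 4)) := by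
  rw [tendsto_iff_dist_tendsto_zero]
  refine squeeze_zero' (Eventually.of_forall fun _ => dist_nonneg) ?_ tendsto_five
  filter_upwards [eventually_ge_atTop 1] with n hn
  have := main_bound n (2 ^ n) hn le_rfl (Nat.pow_lt_pow_right (by norm_num) (by omega))
  have e : ((2 ^ n : ℕ) : ℝ) / 2 ^ n = 1 := by push_cast; field_simp
  rw [e] at this
  rw [Real.dist_eq]
  convert this using 3
  norm_num

lemma tendsto_3pow2 :
    Tendsto (fun n : ℕ => ((3 * 2 ^ n : ℕ) : ℝ) * e1vdc (3 * 2 ^ n)) atTop (nhds (9 / 32)) := by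
  rw [tendsto_iff_dist_tendsto_zero]
  refine squeeze_zero' (Eventually.of_forall fun _ => dist_nonneg) ?_
    (tendsto_five.comp (tendsto_add_atTop_nat 1))
  filter_upwards with n
  have hp := Nat.one_le_two_pow (n := n)
  have := main_bound (n + 1) (3 * 2 ^ n) (by omega) (by rw [pow_succ]; omega)
    (by rw [pow_succ, pow_succ]; omega)
  have e : ((3 * 2 ^ n : ℕ) : ℝ) / 2 ^ (n + 1) = 3 / 2 := by
    push_cast; rw [pow_succ]; field_simp
  rw [e] at this
  rw [Real.dist_eq, Function.comp_apply]
  convert this using 3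
  norm_num

lemma tendsto_ten : Tendsto (fun N : ℕ => (10 : ℝ) / N) atTop (nhds 0) :=
  tendsto_const_div_atTop_nhds_zero_nat 10

lemma ev_lower {ε : ℝ} (hε : 0 < ε) :
    ∀ᶠ N : ℕ in atTop, 1 / 4 - ε ≤ (N : ℝ) * e1vdc N := by
  filter_upwards [eventually_ge_atTop 2, tendsto_ten.eventually_lt_const hε] with N h1 h2
  linarith [(bounds_all N h1).1]

lemma ev_upper {ε : ℝ} (hε : 0 < ε) :
    ∀ᶠ N : ℕ in atTop, (N : ℝ) * e1vdc N ≤ 9 / 32 + ε := by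
  filter_upwards [eventually_ge_atTop 2, tendsto_ten.eventually_lt_const hε] with N h1 h2
  linarith [(bounds_all N h1).2]

theorem stmt_11 :
    liminf (fun N : ℕ => (N : ℝ) * e1vdc N) atTop = 1 / 4 ∧
    Tendsto (fun n : ℕ => ((2 ^ n : ℕ) : ℝ) * e1vdc (2 ^ n)) atTop (nhds (1 / 4)) ∧
    limsup (fun N : ℕ => (N : ℝ) * e1vdc N) atTop = 9 / 32 ∧
    Tendsto (fun n : ℕ => ((3 * 2 ^ n : ℕ) : ℝ) * e1vdc (3 * 2 ^ n)) atTop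
      (nhds (9 / 32)) := by
  have bA : IsBoundedUnder (· ≤ ·) atTop (fun N : ℕ => (N : ℝ) * e1vdc N) :=
    isBoundedUnder_of_eventually_le (ev_upper one_pos)
  have bB : IsBoundedUnder (· ≥ ·) atTop (fun N : ℕ => (N : ℝ) * e1vdc N) :=
    isBoundedUnder_of_eventually_ge (ev_lower one_pos)
  have t2 : Tendsto (fun n : ℕ => 2 ^ n) atTop atTop :=
    tendsto_pow_atTop_atTop_of_one_lt (by norm_num)
  have t3 : Tendsto (fun n : ℕ => 3 * 2 ^ n) atTop atTop :=
    tendsto_atTop_mono (fun n => by omega) t2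
  refine ⟨le_antisymm ?_ ?_, tendsto_pow2, le_antisymm ?_ ?_, tendsto_3pow2⟩
  · apply le_of_forall_pos_le_add
    intro ε hε
    apply liminf_le_of_frequently_le _ bB
    have : ∃ᶠ n : ℕ in atTop, ((2 ^ n : ℕ) : ℝ) * e1vdc (2 ^ n) ≤ 1 / 4 + ε :=
      (tendsto_pow2.eventually_le_const (by linarith)).frequently
    exact t2.frequently this
  · apply le_of_forall_pos_le_add
    intro ε hε
    have := le_liminf_of_le bA.isCoboundedUnder_ge (ev_lower hε)
    linarith
  · apply le_of_forall_pos_le_add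
    intro ε hε
    exact limsup_le_of_le bB.isCoboundedUnder_le (ev_upper hε)
  · apply le_of_forall_pos_le_add
    intro ε hε
    rw [← sub_le_iff_le_add]
    apply le_limsup_of_frequently_le _ bA
    have : ∃ᶠ n : ℕ in atTop, 9 / 32 - ε ≤ ((3 * 2 ^ n : ℕ) : ℝ) * e1vdc (3 * 2 ^ n) :=
      (tendsto_3pow2.eventually_const_le (by linarith)).frequently
    exact t3.frequently this
end

section
/- For the uniform distribution on [0,1] and every level N ≥ 1, the optimal L^1 N-quantizer is Γ_N = {(2k-1)/(2N) : 1 ≤ k ≤ N}, and N·e_1(Γ_N, U([0,1])) = 1/4. -/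
open MeasureTheory Metric

lemma aux_abs (a h : ℝ) (hh : 0 ≤ h) : ∫ u in (a - h)..(a + h), |u - a| = h ^ 2 := by
  rw [intervalIntegral.integral_comp_sub_right (fun x => |x|) a]
  have i : ∀ a b : ℝ, IntervalIntegrable (fun x : ℝ => |x|) volume a b :=
    fun a b => continuous_abs.intervalIntegrable a b
  rw [← intervalIntegral.integral_add_adjacent_intervals (i _ 0) (i 0 _)]
  have h1 : ∫ x in (a - h - a)..0, |x| = ∫ x in (a - h - a)..0, -x := by
    apply intervalIntegral.integral_congr
    intro x hx
    rw [Set.uIcc_of_le (by linarith)] at hx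
    exact abs_of_nonpos hx.2
  have h2 : ∫ x in 0..(a + h - a), |x| = ∫ x in 0..(a + h - a), x := by
    apply intervalIntegral.integral_congr
    intro x hx
    rw [Set.uIcc_of_le (by linarith)] at hx
    exact abs_of_nonneg hx.1
  rw [h1, h2, intervalIntegral.integral_neg, integral_id, integral_id]
  ring

lemma aux_tent (a h : ℝ) (hh : 0 ≤ h) :
    ∫ u in Set.Icc (0 : ℝ) 1, max (h - |u - a|) 0 ≤ h ^ 2 := by
  have hc : Continuous (fun u : ℝ => h - |u - a|) := by fun_prop
  have e : (fun u : ℝ => max (h - |u - a|) 0)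
      = (Set.Icc (a - h) (a + h)).indicator (fun u => h - |u - a|) := by
    ext u
    by_cases hu : u ∈ Set.Icc (a - h) (a + h)
    · rw [Set.indicator_of_mem hu]
      apply max_eq_left
      have : |u - a| ≤ h := abs_le.2 ⟨by linarith [hu.1], by linarith [hu.2]⟩
      linarith
    · rw [Set.indicator_of_notMem hu]
      apply max_eq_right
      by_contra hlt
      have : |u - a| ≤ h := by linarith
      rw [abs_le] at this
      exact hu ⟨by linarith, by linarith⟩
  have hi : Integrable (fun u : ℝ => max (h - |u - a|) 0) := by
    rw [e, integrable_indicator_iff measurableSet_Icc]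
    exact hc.continuousOn.integrableOn_Icc
  calc _ ≤ ∫ u : ℝ, max (h - |u - a|) 0 :=
        setIntegral_le_integral hi (Filter.Eventually.of_forall fun u => le_max_right _ _)
    _ = ∫ u in (a - h)..(a + h), (h - |u - a|) := by
        rw [e, integral_indicator measurableSet_Icc, integral_Icc_eq_integral_Ioc,
          ← intervalIntegral.integral_of_le (by linarith)]
    _ = h ^ 2 := by
        rw [intervalIntegral.integral_sub (by simp)
          ((by fun_prop : Continuous fun u : ℝ => |u - a|).intervalIntegrable _ _), aux_abs a h hh]
        simp
        ring
    _ ≤ _ := le_rfl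

lemma aux_lower (N : ℕ) (hN : 0 < N) (S : Finset ℝ) (hS : S.Nonempty) (hc : S.card ≤ N) :
    1 / (4 * (N : ℝ)) ≤ ∫ u in Set.Icc (0 : ℝ) 1, infDist u (↑S : Set ℝ) := by
  have hN' : (0 : ℝ) < N := by exact_mod_cast hN
  obtain ⟨h, hh⟩ : ∃ h : ℝ, h = 1 / (2 * N) := ⟨_, rfl⟩
  have h0 : 0 ≤ h := by rw [hh]; positivity
  have key : ∀ u : ℝ, h - ∑ a ∈ S, max (h - |u - a|) 0 ≤ infDist u (↑S : Set ℝ) := by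
    intro u
    obtain ⟨a, ha, hd⟩ := (S.finite_toSet.isCompact).exists_infDist_eq_dist hS u
    rw [hd, Real.dist_eq]
    have := Finset.single_le_sum (f := fun a => max (h - |u - a|) 0)
      (fun i _ => le_max_right _ _) (Finset.mem_coe.1 ha)
    have h2 := le_max_left (h - |u - a|) 0
    linarith
  have it : ∀ a : ℝ, IntegrableOn (fun u : ℝ => max (h - |u - a|) 0) (Set.Icc (0 : ℝ) 1) :=
    fun a => (by fun_prop : Continuous (fun u : ℝ => max (h - |u - a|) 0)).continuousOn.integrableOn_Icc
  have is : IntegrableOn (fun u : ℝ => ∑ a ∈ S, max (h - |u - a|) 0) (Set.Icc (0 : ℝ) 1) :=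
    integrable_finsetSum _ fun a _ => it a
  have ic : IntegrableOn (fun _ : ℝ => h) (Set.Icc (0 : ℝ) 1) :=
    continuous_const.continuousOn.integrableOn_Icc
  have m := integral_mono (μ := volume.restrict (Set.Icc (0 : ℝ) 1)) (ic.sub is)
    ((continuous_infDist_pt (↑S : Set ℝ)).continuousOn.integrableOn_Icc) key
  refine le_trans ?_ m
  simp only [Pi.sub_apply]
  rw [integral_sub ic is, integral_finsetSum _ fun a _ => it a]
  have hs : ∑ a ∈ S, ∫ u in Set.Icc (0 : ℝ) 1, max (h - |u - a|) 0 ≤ N * h ^ 2 := by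
    calc _ ≤ ∑ a ∈ S, h ^ 2 := Finset.sum_le_sum fun a _ => aux_tent a h h0
      _ = S.card * h ^ 2 := by simp
      _ ≤ _ := by gcongr
  have h1 : ∫ u in Set.Icc (0 : ℝ) 1, h = h := by simp
  have h2 : h - N * h ^ 2 = 1 / (4 * (N : ℝ)) := by rw [hh]; field_simp; norm_num
  rw [h1]
  linarith

lemma aux_upper (N : ℕ) (hN : 0 < N) :
    ∫ u in Set.Icc (0 : ℝ) 1,
      infDist u (Set.range (fun k : Fin N => (2 * (k : ℝ) + 1) / (2 * N))) ≤ 1 / (4 * (N : ℝ)) := by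
  have hN' : (0 : ℝ) < N := by exact_mod_cast hN
  set Γ := Set.range (fun k : Fin N => (2 * (k : ℝ) + 1) / (2 * N)) with hΓ
  have hc := continuous_infDist_pt Γ
  rw [integral_Icc_eq_integral_Ioc, ← intervalIntegral.integral_of_le zero_le_one]
  have hs := intervalIntegral.sum_integral_adjacent_intervals (μ := volume)
    (f := fun u => infDist u Γ) (a := fun k : ℕ => (k : ℝ) / N) (n := N)
    (fun k _ => hc.intervalIntegrable _ _)
  simp only [Nat.cast_zero, zero_div, div_self hN'.ne'] at hs
  rw [← hs]
  calc _ ≤ ∑ k ∈ Finset.range N, (1 / (2 * (N : ℝ))) ^ 2 := by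
        apply Finset.sum_le_sum
        intro k hk
        have hk := Finset.mem_range.1 hk
        rw [← aux_abs ((2 * (k : ℝ) + 1) / (2 * N)) (1 / (2 * (N : ℝ))) (by positivity)]
        have e1 : (2 * (k : ℝ) + 1) / (2 * N) - 1 / (2 * (N : ℝ)) = k / N := by
          field_simp; ring
        have e2 : (2 * (k : ℝ) + 1) / (2 * N) + 1 / (2 * (N : ℝ)) = ((k + 1 : ℕ) : ℝ) / N := by
          push_cast; field_simp; ring
        rw [e1, e2]
        apply intervalIntegral.integral_mono_on
        · gcongr; simp
        · exact hc.intervalIntegrable _ _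
        · exact (by fun_prop : Continuous fun u : ℝ =>
            |u - (2 * (k : ℝ) + 1) / (2 * N)|).intervalIntegrable _ _
        · intro u _
          rw [← Real.dist_eq]
          exact infDist_le_dist_of_mem ⟨⟨k, hk⟩, rfl⟩
    _ = _ := by
        simp
        field_simp
        norm_num

theorem stmt_12 (N : ℕ) (hN : 0 < N) :
    let Γ : Set ℝ := Set.range (fun k : Fin N => (2 * (k : ℝ) + 1) / (2 * N))
    (∀ S : Finset ℝ, S.Nonempty → S.card ≤ N →
      ∫ u in Set.Icc (0 : ℝ) 1, infDist u Γ
        ≤ ∫ u in Set.Icc (0 : ℝ) 1, infDist u (↑S : Set ℝ)) ∧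
    (N : ℝ) * ∫ u in Set.Icc (0 : ℝ) 1, infDist u Γ = 1 / 4 := by
  intro Γ
  have hN' : (0 : ℝ) < N := by exact_mod_cast hN
  have hu : ∫ u in Set.Icc (0 : ℝ) 1, infDist u Γ ≤ 1 / (4 * (N : ℝ)) := aux_upper N hN
  refine ⟨fun S hS hc => hu.trans (aux_lower N hN S hS hc), ?_⟩
  have hl := aux_lower N hN
    (Finset.univ.image (fun k : Fin N => (2 * (k : ℝ) + 1) / (2 * N)))
    (⟨_, Finset.mem_image_of_mem _ (Finset.mem_univ ⟨0, hN⟩)⟩)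
    (Finset.card_image_le.trans (by simp))
  rw [Finset.coe_image, Finset.coe_univ, Set.image_univ] at hl
  rw [le_antisymm hu hl]
  field_simp
end
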